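/- arXiv:2310.05480 — 7 statements merged into one kernel-verified Lean document; each statement's English description precedes it below -/
import Mathlib

section
/- Let G be a finite connected simple graph, let v_init be a vertex of G, and let k, B be natural numbers. Then the following are equivalent: (i) there exist k closed walks w_1, …, w_k in G from v_init to v_init such that every edge of G is traversed by at least one w_i and each w_i has length at most B; (ii) there exist k multisets Ê_1, …, Ê_k whose elements are edges of G such that: for each i, either Ê_i is empty, or (v_init belongs to some edge of Ê_i, every vertex of G has even degree in Ê_i, and any two vertices each belonging to some edge of Ê_i are joined by a walk in G all of whose edges occur in Ê_i); every edge of G occurs in at least one Ê_i; and the cardinality of each Ê_i (with multiplicity) is at most B. -/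
namespace CGE
open SimpleGraph

theorem even_countP {V : Type*} [DecidableEq V] {G : SimpleGraph V} {u v : V} (p : G.Walk u v)
    (x : V) : Even (Multiset.countP (fun e => x ∈ e) (p.edges : Multiset (Sym2 V))) ↔
      (u ≠ v → x ≠ u ∧ x ≠ v) := by
  induction p with
  | nil => simp
  | @cons a b c h p ih =>
    have hab := h.ne
    rw [Walk.edges_cons, ← Multiset.cons_coe, Multiset.countP_cons]
    by_cases hx : x ∈ s(a, b)
    · rw [if_pos hx, Nat.even_add_one, ih]
      rw [Sym2.mem_iff] at hx
      grind
    · rw [if_neg hx, add_zero, ih]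
      rw [Sym2.mem_iff] at hx
      grind

theorem extend_closed {V : Type*} [DecidableEq V] {G : SimpleGraph V} (R : Multiset (Sym2 V))
    (hR : ∀ e ∈ R, e ∈ G.edgeSet)
    (hev : ∀ u : V, Even (Multiset.countP (fun e => u ∈ e) R)) (x : V) (n : ℕ) :
    ∀ (y : V) (p : G.Walk y x), (p.edges : Multiset (Sym2 V)) ≤ R → 0 < p.length →
      Multiset.card R - p.length = n →
      ∃ c : G.Walk x x, (c.edges : Multiset (Sym2 V)) ≤ R ∧ 0 < c.length := by
  induction n using Nat.strong_induction_on with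
  | _ n ih =>
    intro y p hp hl hn
    by_cases hyx : y = x
    · subst hyx
      exact ⟨p, hp, hl⟩
    · obtain ⟨Q, rfl⟩ := Multiset.le_iff_exists_add.mp hp
      have h1 := hev y
      rw [Multiset.countP_add, Nat.even_add, even_countP] at h1
      have h2 : ¬ Even (Multiset.countP (fun e => y ∈ e) Q) := by
        rw [← h1]; grind
      have h3 : 0 < Multiset.countP (fun e => y ∈ e) Q := by
        rcases Nat.eq_zero_or_pos (Multiset.countP (fun e => y ∈ e) Q) with h | h
        · rw [h] at h2; simp at h2
        · exact h
      obtain ⟨e, heQ, hye⟩ := Multiset.countP_pos.mp h3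
      obtain ⟨z, rfl⟩ := hye
      have hadj : G.Adj y z := hR _ (Multiset.mem_add.mpr (Or.inr heQ))
      obtain ⟨Q', rfl⟩ := Multiset.exists_cons_of_mem heQ
      refine ih _ ?_ z (Walk.cons hadj.symm p) ?_ (by simp) rfl
      · simp at hn ⊢
        omega
      · rw [Walk.edges_cons, ← Multiset.cons_coe, Multiset.add_cons, Sym2.eq_swap]
        exact Multiset.cons_le_cons _ (Multiset.le_add_right _ _)

theorem reach {V : Type*} {G : SimpleGraph V} (E : Multiset (Sym2 V)) (S : V → Prop)
    (hS : ∀ a b, s(a, b) ∈ E → S a → S b) {x y : V} (p : G.Walk x y)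
    (hp : ∀ e ∈ p.edges, e ∈ E) (hx : S x) : S y := by
  induction p with
  | nil => exact hx
  | @cons a b c h p ih =>
    exact ih (fun e he => hp e (by simp [he])) (hS a b (hp _ (by simp)) hx)

theorem euler {V : Type*} [DecidableEq V] {G : SimpleGraph V} (E : Multiset (Sym2 V))
    (hE : ∀ e ∈ E, e ∈ G.edgeSet) (v : V) (hv : ∃ e ∈ E, v ∈ e)
    (hev : ∀ u : V, Even (Multiset.countP (fun e => u ∈ e) E))
    (hc : ∀ x y : V, (∃ e ∈ E, x ∈ e) → (∃ e ∈ E, y ∈ e) →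
             ∃ p : G.Walk x y, ∀ e ∈ p.edges, e ∈ E) (n : ℕ) :
    ∀ w : G.Walk v v, (w.edges : Multiset (Sym2 V)) ≤ E → Multiset.card E - w.length = n →
      ∃ c : G.Walk v v, (c.edges : Multiset (Sym2 V)) = E := by
  induction n using Nat.strong_induction_on with
  | _ n ih =>
    intro w hw hn
    obtain ⟨R, hER⟩ := Multiset.le_iff_exists_add.mp hw
    by_cases hR0 : R = 0
    · exact ⟨w, by rw [hER, hR0, add_zero]⟩
    have key : ∃ x ∈ w.support, ∃ e ∈ R, x ∈ e := by
      by_contra hcon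
      push Not at hcon
      obtain ⟨e, he⟩ := Multiset.exists_mem_of_ne_zero hR0
      induction e with
      | _ a b =>
        obtain ⟨p, hp⟩ := hc v a hv ⟨s(a, b), by rw [hER]; simp [he], by simp⟩
        refine hcon a ?_ _ he (by simp)
        refine reach E (fun z => z ∈ w.support) ?_ p hp w.start_mem_support
        intro c d hcd hcs
        rw [hER, Multiset.mem_add] at hcd
        rcases hcd with h | h
        · exact w.snd_mem_support_of_mem_edges (Multiset.mem_coe.mp h)
        · exact absurd (by simp) (hcon c hcs _ h)
    obtain ⟨x, hxs, e, heR, z, rfl⟩ := key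
    have hRG : ∀ e ∈ R, e ∈ G.edgeSet := fun e he => hE e (by rw [hER]; simp [he])
    have hRev : ∀ u : V, Even (Multiset.countP (fun e => u ∈ e) R) := by
      intro u
      have h1 := hev u
      rw [hER, Multiset.countP_add, Nat.even_add, even_countP] at h1
      exact h1.mp (fun h => absurd rfl h)
    have hadj : G.Adj x z := hRG _ heR
    obtain ⟨c, hcR, hcl⟩ := extend_closed R hRG hRev x _ z (Walk.cons hadj.symm Walk.nil)
      (by
        rw [Walk.edges_cons, Walk.edges_nil, Sym2.eq_swap]
        exact Multiset.singleton_le.mpr heR) (by simp) rfl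
    have hlen : w.length = (w.takeUntil x hxs).length + (w.dropUntil x hxs).length := by
      conv_lhs => rw [← w.take_spec hxs, Walk.length_append]
    have hedges : w.edges = (w.takeUntil x hxs).edges ++ (w.dropUntil x hxs).edges := by
      conv_lhs => rw [← w.take_spec hxs, Walk.edges_append]
    have hcE : c.length ≤ Multiset.card R := by
      have := Multiset.card_le_card hcR
      simpa using this
    have hcard : Multiset.card E = w.length + Multiset.card R := by
      rw [hER]; simp
    refine ih _ ?_ ((w.takeUntil x hxs).append (c.append (w.dropUntil x hxs))) ?_ rfl
    · simp only [Walk.length_append]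
      omega
    · rw [hER, hedges]
      simp only [Walk.edges_append, ← Multiset.coe_add]
      rw [add_assoc, add_comm (c.edges : Multiset (Sym2 V))]
      exact add_le_add le_rfl (add_le_add le_rfl hcR)

end CGE

/-- Reformulation of Collective Graph Exploration via Eulerian cycles:
there exist `k` closed walks from `v_init` covering all edges, each of length
at most `B`, iff there exist `k` multisets of edges, each either empty or
(containing `v_init` in some edge, with all vertex degrees even, and connected),
together covering all edges, each of cardinality at most `B`. -/
theorem stmt_1 {V : Type*} [Fintype V] [DecidableEq V] (G : SimpleGraph V)
    (hG : G.Connected) (v_init : V) (k B : ℕ) :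
    (∃ ws : Fin k → G.Walk v_init v_init,
        (∀ e ∈ G.edgeSet, ∃ i, e ∈ (ws i).edges) ∧ ∀ i, (ws i).length ≤ B) ↔
    (∃ Es : Fin k → Multiset (Sym2 V),
        (∀ i, ∀ e ∈ Es i, e ∈ G.edgeSet) ∧
        (∀ i, Es i = 0 ∨
          ((∃ e ∈ Es i, v_init ∈ e) ∧
           (∀ u : V, Even (Multiset.countP (fun e => u ∈ e) (Es i))) ∧
           (∀ x y : V, (∃ e ∈ Es i, x ∈ e) → (∃ e ∈ Es i, y ∈ e) →
             ∃ p : G.Walk x y, ∀ e ∈ p.edges, e ∈ Es i))) ∧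
        (∀ e ∈ G.edgeSet, ∃ i, e ∈ Es i) ∧
        (∀ i, Multiset.card (Es i) ≤ B)) := by
  constructor
  · rintro ⟨ws, hcov, hlen⟩
    refine ⟨fun i => ((ws i).edges : Multiset (Sym2 V)), ?_, ?_, ?_, ?_⟩
    · intro i e he
      exact (ws i).edges_subset_edgeSet (Multiset.mem_coe.mp he)
    · intro i
      have hsup : ∀ x, (∃ e ∈ ((ws i).edges : Multiset (Sym2 V)), x ∈ e) →
          x ∈ (ws i).support := by
        rintro x ⟨e, he, z, rfl⟩
        exact (ws i).fst_mem_support_of_mem_edges (Multiset.mem_coe.mp he)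
      by_cases h0 : ((ws i).edges : Multiset (Sym2 V)) = 0
      · exact Or.inl h0
      · refine Or.inr ⟨?_, ?_, ?_⟩
        · revert h0
          beta_reduce
          generalize ws i = w
          cases w with
          | nil => intro h0; simp at h0
          | @cons _ b _ h p => intro _; exact ⟨s(v_init, b), by simp, by simp⟩
        · intro u
          exact (CGE.even_countP (ws i) u).mpr (fun h => absurd rfl h)
        · intro x y hx hy
          refine ⟨((ws i).takeUntil x (hsup x hx)).reverse.append
            ((ws i).takeUntil y (hsup y hy)), ?_⟩
          intro e he
          rw [SimpleGraph.Walk.edges_append, List.mem_append, SimpleGraph.Walk.edges_reverse,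
            List.mem_reverse] at he
          rcases he with he | he
          · exact (ws i).edges_takeUntil_subset_edges _ he
          · exact (ws i).edges_takeUntil_subset_edges _ he
    · intro e he
      obtain ⟨i, hi⟩ := hcov e he
      exact ⟨i, hi⟩
    · intro i
      simpa using hlen i
  · rintro ⟨Es, hG', hE, hcov, hB⟩
    have H : ∀ i, ∃ c : G.Walk v_init v_init, (c.edges : Multiset (Sym2 V)) = Es i := by
      intro i
      rcases hE i with h0 | ⟨hv, hev, hc⟩
      · exact ⟨SimpleGraph.Walk.nil, by rw [h0]; rfl⟩
      · exact CGE.euler (Es i) (hG' i) v_init hv hev hc _ SimpleGraph.Walk.nil (by simp) rfl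
    choose ws hws using H
    refine ⟨ws, ?_, ?_⟩
    · intro e he
      obtain ⟨i, hi⟩ := hcov e he
      exact ⟨i, by rw [← hws i] at hi; exact hi⟩
    · intro i
      have := hB i
      rw [← hws i] at this
      simpa using this
end

section
/- Let G be a finite connected simple graph, let v_init be a vertex of G, and let k, B be natural numbers. Suppose there exist k multisets Ê_1, …, Ê_k of edges of G such that: for each i, either Ê_i is empty, or (v_init belongs to some edge of Ê_i, every vertex of G has even degree in Ê_i, and any two vertices each belonging to some edge of Ê_i are joined by a walk in G all of whose edges occur in Ê_i); every edge of G occurs in at least one Ê_i; and |Ê_i| ≤ B for each i. Then there exist multisets Ê'_1, …, Ê'_k satisfying the same four conditions and, in addition, every edge occurs at most twice in each Ê'_i. -/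
/-- The four conditions of the Eulerian-cycle reformulation of Collective Graph
Exploration for a family of edge multisets `Es`: each multiset consists of edges
of `G`; each multiset is empty or (contains `v_init` in some edge, has all vertex
degrees even, and is connected); every edge of `G` occurs in some multiset; and
each multiset has cardinality at most `B`. -/
def GoodFamily {V : Type*} [Fintype V] [DecidableEq V] (G : SimpleGraph V)
    (v_init : V) (k B : ℕ) (Es : Fin k → Multiset (Sym2 V)) : Prop :=
  (∀ i, ∀ e ∈ Es i, e ∈ G.edgeSet) ∧
  (∀ i, Es i = 0 ∨
    ((∃ e ∈ Es i, v_init ∈ e) ∧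
     (∀ u : V, Even (Multiset.countP (fun e => u ∈ e) (Es i))) ∧
     (∀ x y : V, (∃ e ∈ Es i, x ∈ e) → (∃ e ∈ Es i, y ∈ e) →
       ∃ p : G.Walk x y, ∀ e ∈ p.edges, e ∈ Es i))) ∧
  (∀ e ∈ G.edgeSet, ∃ i, e ∈ Es i) ∧
  (∀ i, Multiset.card (Es i) ≤ B)

/-- Deleting pairs of copies until every multiplicity is at most two. -/
theorem reduce_multiset {α : Type*} [DecidableEq α] (n : ℕ) : ∀ m : Multiset α,
    Multiset.card m = n → ∃ m' : Multiset α, (∀ a, a ∈ m' ↔ a ∈ m) ∧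
      (∀ (p : α → Prop) [DecidablePred p], Even (m.countP p) → Even (m'.countP p)) ∧
      Multiset.card m' ≤ Multiset.card m ∧ ∀ a, m'.count a ≤ 2 := by
  induction n using Nat.strong_induction_on with
  | _ n ih =>
    intro m hm
    by_cases h : ∀ a, m.count a ≤ 2
    · exact ⟨m, fun _ => Iff.rfl, fun _ _ h => h, le_rfl, h⟩
    · push Not at h
      obtain ⟨a, ha⟩ := h
      have h3 : Multiset.replicate 3 a ≤ m := Multiset.le_count_iff_replicate_le.mp ha
      obtain ⟨r, rfl⟩ := Multiset.le_iff_exists_add.mp h3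
      have hc : Multiset.card (a ::ₘ r) < n := by
        rw [← hm]; simp
      obtain ⟨m', h1, h2, h4, h5⟩ := ih _ hc (a ::ₘ r) rfl
      refine ⟨m', ?_, ?_, ?_, h5⟩
      · intro b
        rw [h1]
        simp [Multiset.mem_replicate]
      · intro p _ hp
        apply h2
        have e : Multiset.replicate 3 a + r = a ::ₘ a ::ₘ a ::ₘ r := by
          simp [Multiset.replicate_succ]
        rw [e] at hp
        by_cases hpa : p a
        · simp only [Multiset.countP_cons, hpa, if_true] at hp ⊢
          grind
        · simpa [Multiset.countP_cons, hpa] using hp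
      · omega

/-- A solution in the multiset formulation can be replaced by one in which every
edge occurs at most twice in each robot's edge multiset. -/
theorem stmt_2 {V : Type*} [Fintype V] [DecidableEq V] (G : SimpleGraph V)
    (hG : G.Connected) (v_init : V) (k B : ℕ)
    (Es : Fin k → Multiset (Sym2 V)) (hEs : GoodFamily G v_init k B Es) :
    ∃ Es' : Fin k → Multiset (Sym2 V),
      GoodFamily G v_init k B Es' ∧ ∀ i, ∀ e : Sym2 V, (Es' i).count e ≤ 2 := by
  choose Es' h1 h2 h3 h4 using fun i => reduce_multiset _ (Es i) rfl
  obtain ⟨g1, g2, g3, g4⟩ := hEs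
  refine ⟨Es', ⟨?_, ?_, ?_, ?_⟩, h4⟩
  · intro i e he
    exact g1 i e ((h1 i e).mp he)
  · intro i
    rcases g2 i with h | ⟨ha, hb, hc⟩
    · left
      have := h3 i
      rw [h] at this
      simpa using this
    · right
      simp only [h1]
      exact ⟨ha, fun u => h2 i _ (hb u), hc⟩
  · simpa only [h1] using g3
  · intro i
    exact (h3 i).trans (g4 i)
end

section
/- Let G be a finite simple graph, let C be a vertex cover of G, and suppose every vertex of G has even degree and the number of edges of G is strictly greater than 2·|C|². Then G contains a cycle of length 4, i.e., there exist a vertex v and a closed walk from v to v of length 4 that is a cycle. -/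
/-- If every vertex of `G` has even degree, `C` is a vertex cover of `G`, and
`G` has more than `2·|C|²` edges, then `G` contains a cycle of length `4`. -/
theorem stmt_6 {V : Type*} [Fintype V] [DecidableEq V] (G : SimpleGraph V)
    [DecidableRel G.Adj]
    (C : Finset V) (hC : ∀ e ∈ G.edgeSet, ∃ x ∈ C, x ∈ e)
    (heven : ∀ v : V, Even (G.degree v))
    (hcard : 2 * C.card ^ 2 < G.edgeFinset.card) :
    ∃ (v : V) (c : G.Walk v v), c.IsCycle ∧ c.length = 4 := by
  by_contra hno
  have key : ∀ a b v w : V, G.Adj v a → G.Adj v b → G.Adj w a → G.Adj w b → a ≠ b → v = w := by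
    intro a b v w h1 h2 h3 h4 hab
    by_contra hvw
    apply hno
    refine ⟨a, .cons h1.symm (.cons h2 (.cons h4.symm (.cons h3 .nil))), ?_, by simp⟩
    have e1 := h1.ne
    have e2 := h2.ne
    have e3 := h3.ne
    have e4 := h4.ne
    rw [SimpleGraph.Walk.cons_isCycle_iff]
    constructor
    · simp [SimpleGraph.Walk.cons_isPath_iff]
      grind
    · simp
      grind
  have hC' : ∀ v w, G.Adj v w → v ∈ C ∨ w ∈ C := by
    intro v w h
    obtain ⟨x, hx, hxe⟩ := hC s(v, w) h
    rcases Sym2.mem_iff.1 hxe with rfl | rfl <;> simp [hx]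
  have hex : ∀ v a : V, ∃ b, G.Adj v a → b ≠ a ∧ G.Adj v b := by
    intro v a
    by_cases h : G.Adj v a
    · have h0 : 0 < G.degree v := (G.degree_pos_iff_exists_adj v).2 ⟨a, h⟩
      have h1 : 1 < (G.neighborFinset v).card := by
        rw [G.card_neighborFinset_eq_degree]
        have := heven v
        grind
      obtain ⟨b, hb, hba⟩ := Finset.exists_mem_ne h1 a
      exact ⟨b, fun _ => ⟨hba, by simpa using hb⟩⟩
    · exact ⟨a, fun h' => absurd h' h⟩
  choose f hf using hex
  let S : Finset (V × V) := Finset.univ.filter (fun p => p.1 ∉ C ∧ G.Adj p.1 p.2)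
  have hS : S.card ≤ (C ×ˢ C).card := by
    apply Finset.card_le_card_of_injOn (fun p => (p.2, f p.1 p.2))
    · rintro ⟨v, a⟩ h
      simp only [S, Finset.coe_filter, Finset.mem_univ, true_and, Set.mem_setOf_eq] at h
      have := hC' _ _ h.2
      have := hC' _ _ (hf v a h.2).2
      simp
      tauto
    · rintro ⟨v, a⟩ h ⟨w, b⟩ h' heq
      simp only [S, Finset.coe_filter, Finset.mem_univ, true_and, Set.mem_setOf_eq] at h h'
      simp only [Prod.mk.injEq] at heq
      obtain ⟨rfl, h2⟩ := heq
      have p := hf v a h.2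
      have q := hf w a h'.2
      rw [← h2] at q
      rw [key a (f v a) v w h.2 p.2 h'.2 q.2 p.1.symm]
  have hsub : G.edgeFinset ⊆ (C ×ˢ C ∪ S).image (fun p => s(p.1, p.2)) := by
    intro e he
    induction e with
    | _ v w =>
      have h : G.Adj v w := by simpa using he
      rw [Finset.mem_image]
      by_cases hv : v ∈ C
      · by_cases hw : w ∈ C
        · exact ⟨(v, w), by simp [hv, hw], rfl⟩
        · exact ⟨(w, v), by simp [S, hw, h.symm], Sym2.eq_swap⟩
      · exact ⟨(v, w), by simp [S, hv, h], rfl⟩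
  have h1 := (Finset.card_le_card hsub).trans Finset.card_image_le
  have h2 := Finset.card_union_le (C ×ˢ C) S
  rw [Finset.card_product] at *
  nlinarith
end

section
/- Let G be a finite simple graph, let C be a vertex cover of G, and suppose every vertex of G has even degree. Then there exists a finite family of cycles in G whose edge sets are pairwise disjoint and whose union is the edge set of G, and such that at most 2·|C|² of the cycles in the family have length different from 4. -/
namespace CycDec

open SimpleGraph

/-- All degrees are even (instance-free form). -/
def Ev {V : Type*} (G : SimpleGraph V) : Prop := ∀ v, Even (G.incidenceSet v).ncard

/-- Cycle decomposition with at most `m` cycles of length other than four. -/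
def Dec {V : Type*} (G : SimpleGraph V) (m : ℕ) : Prop :=
  ∃ (ι : Type) (_ : Fintype ι) (vs : ι → V) (cs : ∀ i, G.Walk (vs i) (vs i)) (T : Finset ι),
      (∀ i, (cs i).IsCycle) ∧
      (∀ i j, i ≠ j →
        Disjoint ({e | e ∈ (cs i).edges} : Set (Sym2 V))
          {e | e ∈ (cs j).edges}) ∧
      (⋃ i, ({e | e ∈ (cs i).edges} : Set (Sym2 V))) = G.edgeSet ∧
      T.card ≤ m ∧ ∀ i, i ∉ T → (cs i).length = 4

/-- Removing a cycle. -/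
abbrev rem {V : Type*} (G : SimpleGraph V) {v : V} (c : G.Walk v v) : SimpleGraph V :=
  G.deleteEdges {e | e ∈ c.edges}

theorem ev_rem {V : Type*} [Finite V] {G : SimpleGraph V} (h : Ev G) {v : V} (c : G.Walk v v)
    (hc : c.IsCycle) : Ev (rem G c) := by
  classical
  intro x
  have h1 : (rem G c).incidenceSet x =
      G.incidenceSet x \ ((c.edges.filter (fun e => x ∈ e)).toFinset : Set (Sym2 V)) := by
    ext e
    simp only [SimpleGraph.incidenceSet, rem, SimpleGraph.edgeSet_deleteEdges, 
      Set.mem_sdiff, Set.mem_ofPred_eq, List.coe_toFinset, List.mem_filter, decide_eq_true_eq]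
    tauto
  have h2 : ((c.edges.filter (fun e => x ∈ e)).toFinset : Set (Sym2 V)) ⊆ G.incidenceSet x := by
    intro e he
    simp only [List.coe_toFinset, Set.mem_ofPred_eq, List.mem_filter, decide_eq_true_eq] at he
    exact ⟨c.edges_subset_edgeSet he.1, he.2⟩
  have h3 : Even (c.edges.filter (fun e => x ∈ e)).toFinset.card := by
    rw [List.toFinset_card_of_nodup (hc.isTrail.edges_nodup.filter _),
      ← List.countP_eq_length_filter]
    have := hc.isTrail.even_countP_edges_iff x
    exact this.2 (fun h => absurd rfl h)
  rw [h1, Set.ncard_sdiff h2 (Set.toFinite _), Set.ncard_coe_finset]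
  exact Even.tsub (h x) h3

theorem ncard_rem {V : Type*} [Finite V] {G : SimpleGraph V} {v : V} (c : G.Walk v v)
    (hc : c.IsCycle) : (rem G c).edgeSet.ncard + 1 ≤ G.edgeSet.ncard := by
  refine Set.ncard_lt_ncard ?_ (Set.toFinite _)
  rw [SimpleGraph.edgeSet_deleteEdges]
  refine ⟨Set.sdiff_subset, fun hh => ?_⟩
  have hl := hc.three_le_length
  rw [← c.length_edges] at hl
  obtain ⟨e, he⟩ := List.exists_mem_of_length_pos (by omega : 0 < c.edges.length)
  exact (hh (c.edges_subset_edgeSet he)).2 he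

theorem dec_step {V : Type*} {G : SimpleGraph V} {v : V} (c : G.Walk v v)
    (hc : c.IsCycle) {m k : ℕ} (h : Dec (rem G c) m) (hk : c.length = 4 ∧ m ≤ k ∨ m + 1 ≤ k) :
    Dec G k := by
  classical
  obtain ⟨ι, _, vs, cs, T, h1, h2, h3, h4, h5⟩ := h
  have hle : ∀ i, ∀ e ∈ (cs i).edges, e ∈ G.edgeSet := fun i e he => by
    have := (cs i).edges_subset_edgeSet he
    rw [SimpleGraph.edgeSet_deleteEdges] at this
    exact this.1
  have hnot : ∀ i, ∀ e ∈ (cs i).edges, e ∉ c.edges := fun i e he => by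
    have := (cs i).edges_subset_edgeSet he
    rw [SimpleGraph.edgeSet_deleteEdges] at this
    exact this.2
  have tr : ∀ i e, e ∈ ((cs i).transfer G (hle i)).edges ↔ e ∈ (cs i).edges := fun i e => by
    rw [Walk.edges_transfer]
  refine ⟨Option ι, inferInstance, fun o => o.elim v vs,
    fun o => match o with
      | none => c
      | some i => (cs i).transfer G (hle i),
    if c.length = 4 then T.map Function.Embedding.some else Finset.insertNone T, ?_, ?_, ?_, ?_, ?_⟩
  · rintro (_ | i)
    · exact hc
    · exact (h1 i).transfer _
  · rintro (_ | i) (_ | j) hij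
    · exact absurd rfl hij
    · rw [Set.disjoint_left]
      intro e he he'
      exact hnot j e ((tr j e).1 he') he
    · rw [Set.disjoint_left]
      intro e he' he
      exact hnot i e ((tr i e).1 he') he
    · have := h2 i j (fun h => hij (by rw [h]))
      rw [Set.disjoint_left] at this ⊢
      exact fun e he he' => this ((tr i e).1 he) ((tr j e).1 he')
  · have h6 : G.edgeSet = {e | e ∈ c.edges} ∪ (rem G c).edgeSet := by
      rw [SimpleGraph.edgeSet_deleteEdges, Set.union_sdiff_self, Set.union_eq_self_of_subset_left]
      exact fun e he => c.edges_subset_edgeSet he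
    rw [h6, ← h3]
    ext e
    simp [Option.exists]
  · split_ifs with h
    · rw [Finset.card_map]; omega
    · rw [Finset.card_insertNone]; omega
  · rintro (_ | i) hi
    · by_contra hh
      have hh' : ¬ c.length = 4 := hh
      rw [if_neg hh'] at hi
      simp at hi
    · refine (Walk.length_transfer (cs i) (hle i)).trans (h5 i ?_)
      intro hT
      apply hi
      split_ifs <;> simp [hT]

theorem exists_other {V : Type*} [Finite V] {G : SimpleGraph V} (h : Ev G) {u v : V}
    (huv : G.Adj u v) : ∃ w, w ≠ v ∧ G.Adj u w := by
  have he : s(u, v) ∈ G.incidenceSet u := ⟨huv, by simp⟩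
  have h1 : 1 < (G.incidenceSet u).ncard := by
    have h0 : 0 < (G.incidenceSet u).ncard := (Set.ncard_pos (Set.toFinite _)).2 ⟨_, he⟩
    obtain ⟨r, hr⟩ := h u
    omega
  obtain ⟨e, he', hne⟩ := Set.exists_ne_of_one_lt_ncard h1 s(u, v)
  obtain ⟨w, rfl⟩ := Sym2.mem_iff_exists.1 he'.2
  exact ⟨w, fun h => hne (by rw [h]), he'.1⟩

theorem exists_cycle {V : Type*} [Finite V] {G : SimpleGraph V} (h : Ev G) {a b : V}
    (hab : G.Adj a b) : ∃ (v : V) (c : G.Walk v v), c.IsCycle := by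
  classical
  by_contra! hcon
  have hac : G.IsAcyclic := fun v c hc => hcon v c hc
  have : Nonempty V := ⟨a⟩
  obtain ⟨u, v, p, hp, hmax⟩ := Walk.exists_isPath_forall_isPath_length_le_length G
  have hnil : ¬p.Nil := by
    intro hn
    have := hmax a b (Walk.cons hab Walk.nil) (by simp [hab.ne])
    rw [Walk.nil_iff_length_eq.1 hn] at this
    simp at this
  obtain ⟨w, hw, hadj⟩ := exists_other h (p.adj_snd hnil)
  apply hw
  apply hac.eq_snd_of_adj_start hp hadj
  by_contra hns
  have := hmax _ _ (p.cons hadj.symm) (hp.cons hns)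
  rw [Walk.length_cons] at this
  omega

theorem dec_empty {V : Type*} {G : SimpleGraph V} (hG : G.edgeSet = ∅) (m : ℕ) : Dec G m := by
  refine ⟨Empty, inferInstance, fun i => i.elim, fun i => i.elim, ∅, fun i => i.elim,
    fun i => i.elim, ?_, by simp, fun i => i.elim⟩
  simp [hG]

theorem dec_edges {V : Type*} [Finite V] (m : ℕ) : ∀ (G : SimpleGraph V), Ev G →
    G.edgeSet.ncard ≤ m → Dec G m := by
  induction m with
  | zero =>
    intro G _ h0
    exact dec_empty ((Set.ncard_eq_zero (Set.toFinite _)).1 (by omega)) 0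
  | succ m ih =>
    intro G hG hm
    by_cases hE : G.edgeSet = ∅
    · exact dec_empty hE _
    obtain ⟨e, he⟩ := Set.nonempty_iff_ne_empty.2 hE
    induction e with
    | h a b =>
      obtain ⟨v, c, hc⟩ := exists_cycle hG (a := a) (b := b) he
      have := ncard_rem c hc
      exact dec_step c hc (ih _ (ev_rem hG c hc) (by omega)) (Or.inr le_rfl)

theorem edges_le {V : Type*} [Finite V] {G : SimpleGraph V} (hG : Ev G) (C : Finset V)
    (hC : ∀ e ∈ G.edgeSet, ∃ x ∈ C, x ∈ e)
    (h4 : ∀ (v : V) (c : G.Walk v v), c.IsCycle → c.length ≠ 4) :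
    G.edgeSet.ncard ≤ 2 * C.card ^ 2 := by
  classical
  have huniq : ∀ x y v w, x ≠ y → G.Adj x v → G.Adj v y → G.Adj x w → G.Adj w y → v = w := by
    intro x y v w hxy h1 h2 h3 h5
    by_contra hvw
    refine h4 x (Walk.cons h1 (Walk.cons h2 (Walk.cons h5.symm (Walk.cons h3.symm Walk.nil)))) ?_ rfl
    rw [Walk.cons_isCycle_iff]
    have := h1.ne
    have := h2.ne
    have := h3.ne
    have := h5.ne
    constructor
    · simp [Walk.cons_isPath_iff]
      grind
    · simp
      grind
  let f : V × V → Sym2 V := fun p => s(p.1, p.2)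
  let g : V × V → Sym2 V := fun p =>
    if h : ∃ v, G.Adj p.1 v ∧ G.Adj v p.2 then s(p.1, h.choose) else s(p.1, p.2)
  have hsub : G.edgeSet ⊆ (((C ×ˢ C).image f ∪ (C ×ˢ C).image g : Finset (Sym2 V)) : Set _) := by
    intro e he
    obtain ⟨x, hx, hxe⟩ := hC e he
    obtain ⟨v, rfl⟩ := Sym2.mem_iff_exists.1 hxe
    have hxv : G.Adj x v := he
    rw [Finset.mem_coe, Finset.mem_union]
    by_cases hv : v ∈ C
    · left
      exact Finset.mem_image.2 ⟨(x, v), by simp [hx, hv], rfl⟩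
    · right
      obtain ⟨y, hy, hvy⟩ := exists_other hG hxv.symm
      have hyC : y ∈ C := by
        obtain ⟨z, hz, hze⟩ := hC s(v, y) hvy
        rcases Sym2.mem_iff.1 hze with rfl | rfl
        · exact absurd hz hv
        · exact hz
      refine Finset.mem_image.2 ⟨(x, y), by simp [hx, hyC], ?_⟩
      have hex : ∃ v, G.Adj x v ∧ G.Adj v y := ⟨v, hxv, hvy⟩
      have : hex.choose = v :=
        huniq x y _ _ hy.symm hex.choose_spec.1 hex.choose_spec.2 hxv hvy
      simp only [g]
      rw [dif_pos hex, this]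
  calc G.edgeSet.ncard ≤ _ := Set.ncard_le_ncard hsub (Set.toFinite _)
    _ = _ := Set.ncard_coe_finset _
    _ ≤ _ := Finset.card_union_le _ _
    _ ≤ (C ×ˢ C).card + (C ×ˢ C).card := Nat.add_le_add Finset.card_image_le Finset.card_image_le
    _ = _ := by rw [Finset.card_product]; ring

theorem dec_main {V : Type*} [Finite V] (C : Finset V) (m : ℕ) : ∀ (G : SimpleGraph V), Ev G →
    (∀ e ∈ G.edgeSet, ∃ x ∈ C, x ∈ e) → G.edgeSet.ncard ≤ m → Dec G (2 * C.card ^ 2) := by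
  induction m with
  | zero =>
    intro G _ _ h0
    exact dec_empty ((Set.ncard_eq_zero (Set.toFinite _)).1 (by omega)) _
  | succ m ih =>
    intro G hG hC hm
    by_cases h4 : ∀ (v : V) (c : G.Walk v v), c.IsCycle → c.length ≠ 4
    · exact dec_edges _ G hG (edges_le hG C hC h4)
    · push Not at h4
      obtain ⟨v, c, hc, hl⟩ := h4
      have := ncard_rem c hc
      refine dec_step c hc (ih _ (ev_rem hG c hc) ?_ (by omega)) (Or.inl ⟨hl, le_rfl⟩)
      intro e he
      rw [SimpleGraph.edgeSet_deleteEdges] at he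
      exact hC e he.1

end CycDec

/-- If every vertex of `G` has even degree and `C` is a vertex cover of `G`,
then the edge set of `G` decomposes into a finite family of edge-disjoint
cycles, at most `2·|C|²` of which have length different from `4`. -/
theorem stmt_7 {V : Type*} [Fintype V] [DecidableEq V] (G : SimpleGraph V)
    [DecidableRel G.Adj]
    (C : Finset V) (hC : ∀ e ∈ G.edgeSet, ∃ x ∈ C, x ∈ e)
    (heven : ∀ v : V, Even (G.degree v)) :
    ∃ (n : ℕ) (vs : Fin n → V) (cs : ∀ i, G.Walk (vs i) (vs i)),
      (∀ i, (cs i).IsCycle) ∧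
      (∀ i j, i ≠ j →
        Disjoint ({e | e ∈ (cs i).edges} : Set (Sym2 V))
          {e | e ∈ (cs j).edges}) ∧
      (⋃ i, ({e | e ∈ (cs i).edges} : Set (Sym2 V))) = G.edgeSet ∧
      (Finset.univ.filter fun i => (cs i).length ≠ 4).card ≤ 2 * C.card ^ 2 := by
  have hE : CycDec.Ev G := fun v => by
    have := heven v
    rwa [← SimpleGraph.card_incidenceFinset_eq_degree, ← Set.ncard_coe_finset,
      SimpleGraph.coe_incidenceFinset] at this
  obtain ⟨ι, _, vs, cs, T, h1, h2, h3, h4, h5⟩ := CycDec.dec_main C _ G hE hC le_rfl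
  let σ := (Fintype.equivFin ι).symm
  refine ⟨Fintype.card ι, fun i => vs (σ i), fun i => cs (σ i), fun i => h1 _,
    fun i j hij => h2 _ _ (fun h => hij (σ.injective h)), ?_, ?_⟩
  · rw [← h3]
    exact σ.surjective.iUnion_comp (fun i => {e | e ∈ (cs i).edges})
  · refine le_trans ?_ h4
    refine Finset.card_le_card_of_injOn σ ?_ σ.injective.injOn
    intro i hi
    by_contra hh
    exact (Finset.mem_filter.1 hi).2 (h5 _ hh)
end

section
/- Let G be a finite simple graph in which every vertex has even degree, let F be a subset of the edge set of G, and let v be a vertex whose degree in the spanning subgraph with edge set F is odd. Then there exists a vertex u ≠ v whose degree in the spanning subgraph with edge set F is also odd, such that v and u are joined by a walk all of whose edges belong to E(G) \ F. -/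
/-- Let `G` be a finite simple graph with all degrees even, `F` a subset of its
edge set, and `v` a vertex of odd degree in the spanning subgraph with edge set
`F`. Then there is another vertex `u ≠ v` of odd degree in `F` reachable from
`v` by a walk using only edges of `G` not in `F`. -/
theorem stmt_9 {V : Type*} [Fintype V] [DecidableEq V] (G : SimpleGraph V)
    [DecidableRel G.Adj]
    (heven : ∀ w : V, Even (G.degree w))
    (F : Finset (Sym2 V)) (hF : ↑F ⊆ G.edgeSet)
    (v : V) (hv : Odd ((F.filter fun e => v ∈ e).card)) :
    ∃ u : V, u ≠ v ∧ Odd ((F.filter fun e => u ∈ e).card) ∧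
      (G.deleteEdges ↑F).Reachable v u := by
  classical
  set H := G.deleteEdges (F : Set (Sym2 V)) with hH
  have hdeg : ∀ w, H.degree w + (F.filter fun e => w ∈ e).card = G.degree w := by
    intro w
    rw [← SimpleGraph.card_incidenceFinset_eq_degree, ← SimpleGraph.card_incidenceFinset_eq_degree,
      ← Finset.card_union_of_disjoint]
    · congr 1
      ext e
      have h1 : e ∈ F → e ∈ G.edgeSet := fun h => hF h
      simp only [Finset.mem_union, SimpleGraph.mem_incidenceFinset, SimpleGraph.incidenceSet,
        Finset.mem_filter, Set.mem_ofPred_eq, hH, SimpleGraph.edgeSet_deleteEdges, Set.mem_sdiff,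
        Finset.mem_coe]
      tauto
    · rw [Finset.disjoint_left]
      intro e
      simp only [SimpleGraph.mem_incidenceFinset, SimpleGraph.incidenceSet,
        Finset.mem_filter, Set.mem_ofPred_eq, hH, SimpleGraph.edgeSet_deleteEdges, Set.mem_sdiff,
        Finset.mem_coe]
      tauto
  have hpar : ∀ w, Odd (H.degree w) ↔ Odd ((F.filter fun e => w ∈ e).card) := by
    intro w
    have h1 := heven w
    rw [← hdeg w, Nat.even_add, ← Nat.not_odd_iff_even, ← Nat.not_odd_iff_even] at h1
    tauto
  let K : SimpleGraph V :=
    { Adj := fun a b => H.Adj a b ∧ H.Reachable v a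
      symm := ⟨fun a b h => ⟨h.1.symm, h.2.trans h.1.reachable⟩⟩
      loopless := ⟨fun a h => H.loopless.irrefl a h.1⟩ }
  have hK : ∀ (w) [Fintype (K.neighborSet w)], H.Reachable v w → K.degree w = H.degree w := by
    intro w _ hw
    rw [← SimpleGraph.card_neighborFinset_eq_degree, ← SimpleGraph.card_neighborFinset_eq_degree]
    congr 1
    ext x
    simp [K, hw]
  have hex : ∃ u, u ≠ v ∧ Odd (K.degree u) := by
    have h1 : Odd (K.degree v) := by
      rw [hK v (SimpleGraph.Reachable.refl v), hpar]
      exact hv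
    have h2 := K.exists_ne_odd_degree_of_exists_odd_degree v (by convert h1)
    convert h2
  obtain ⟨u, hu, hodd⟩ := hex
  obtain ⟨x, hx⟩ := (SimpleGraph.degree_pos_iff_exists_adj _ u).1 hodd.pos
  exact ⟨u, hu, by rwa [← hpar, ← hK u hx.2], hx.2⟩
end

section
/- Let I be a finite set, let s : I → ℕ with s(i) ≥ 1 for all i ∈ I, and let B ≥ 1 and k ≥ 1 be natural numbers with ∑_{i ∈ I} s(i) ≤ B·k; set t = B·k − ∑_{i ∈ I} s(i). Define s' on I ⊕ Fin t by s'(inl i) = s(i) and s'(inr ℓ) = 1. Then there exists a function f : I → Fin k such that for every j, ∑_{i : f(i) = j} s(i) ≤ B, if and only if there exists a function g : I ⊕ Fin t → Fin k such that for every j, ∑_{x : g(x) = j} s'(x) = B. -/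
/-- Reduction from Bin Packing to Exact Bin Packing: padding the instance with
`B·k − ∑ s(i)` unit-size items yields an equivalent instance in which every bin
must be filled exactly. -/
theorem stmt_11 {I : Type*} [Fintype I] [DecidableEq I]
    (s : I → ℕ) (hs : ∀ i, 1 ≤ s i) (B k : ℕ) (hB : 1 ≤ B) (hk : 1 ≤ k)
    (hsum : ∑ i, s i ≤ B * k) :
    (∃ f : I → Fin k,
        ∀ j : Fin k, ∑ i ∈ Finset.univ.filter (fun i => f i = j), s i ≤ B) ↔
    (∃ g : I ⊕ Fin (B * k - ∑ i, s i) → Fin k,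
        ∀ j : Fin k, ∑ x ∈ Finset.univ.filter (fun x => g x = j),
          Sum.elim s (fun _ => 1) x = B) := by
  have key : ∀ (t : ℕ) (g : I ⊕ Fin t → Fin k) (j : Fin k),
      ∑ x ∈ Finset.univ.filter (fun x => g x = j), Sum.elim s (fun _ => 1) x =
      ∑ i ∈ Finset.univ.filter (fun i => g (Sum.inl i) = j), s i +
      ∑ l : Fin t, if g (Sum.inr l) = j then 1 else 0 := by
    intro t g j
    rw [Finset.sum_filter, Finset.sum_filter, Fintype.sum_sum_type]
    simp only [Sum.elim_inl, Sum.elim_inr]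
  constructor
  · rintro ⟨f, hf⟩
    have htot : ∑ j : Fin k, ∑ i ∈ Finset.univ.filter (fun i => f i = j), s i = ∑ i, s i :=
      Finset.sum_fiberwise _ _ _
    have hcard : ∑ j : Fin k, (B - ∑ i ∈ Finset.univ.filter (fun i => f i = j), s i)
        = B * k - ∑ i, s i := by
      have h2 : ∑ j : Fin k, (B - ∑ i ∈ Finset.univ.filter (fun i => f i = j), s i)
          + ∑ j : Fin k, ∑ i ∈ Finset.univ.filter (fun i => f i = j), s i = B * k := by
        rw [← Finset.sum_add_distrib, Finset.sum_congr rfl (fun j _ => Nat.sub_add_cancel (hf j))]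
        simp [mul_comm]
      omega
    rw [← hcard]
    refine ⟨Sum.elim f (fun l => (finSigmaFinEquiv.symm l).1), fun j => ?_⟩
    rw [key]
    have hc : (∑ l : Fin (∑ j : Fin k, (B - ∑ i ∈ Finset.univ.filter (fun i => f i = j), s i)),
        if (finSigmaFinEquiv.symm l).1 = j then 1 else 0)
        = B - ∑ i ∈ Finset.univ.filter (fun i => f i = j), s i := by
      rw [Equiv.sum_comp finSigmaFinEquiv.symm
        (fun p : (j : Fin k) × Fin (B - ∑ i ∈ Finset.univ.filter (fun i => f i = j), s i) =>
          if p.1 = j then 1 else 0), Fintype.sum_sigma,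
        Fintype.sum_eq_single j (fun x hx => by simp [hx])]
      simp
    change ∑ i ∈ Finset.univ.filter (fun i => f i = j), s i +
      (∑ l : Fin (∑ j : Fin k, (B - ∑ i ∈ Finset.univ.filter (fun i => f i = j), s i)),
        if (finSigmaFinEquiv.symm l).1 = j then 1 else 0) = B
    rw [hc]
    exact Nat.add_sub_cancel' (hf j)
  · rintro ⟨g, hg⟩
    refine ⟨fun i => g (Sum.inl i), fun j => ?_⟩
    have h := hg j
    rw [key] at h
    exact (Nat.le_add_right _ _).trans h.le
end

section
/- Let I be a finite set, let s : I → ℕ with s(i) ≥ 1 for all i ∈ I, and let B ≥ 1 and k ≥ 1 be natural numbers with ∑_{i ∈ I} s(i) = B·k. Let T be the tree with vertex set {r} ∪ {v_i : i ∈ I} ∪ {v_{i,t} : i ∈ I, 1 ≤ t ≤ s(i) − 1} and edge set {{r, v_i} : i ∈ I} ∪ {{v_i, v_{i,t}} : i ∈ I, 1 ≤ t ≤ s(i) − 1}. Then there exists a function f : I → Fin k with ∑_{i : f(i) = j} s(i) = B for every j, if and only if there exist k closed walks in T from r to r, each of length at most 2B, such that every edge of T is traversed by at least one of the walks. -/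
/-- The tree built from an Exact Bin Packing instance: a root `none`, a star
center `some ⟨i, none⟩` for each item `i`, joined to the root, and `s i − 1`
leaves `some ⟨i, some t⟩` attached to each center. -/
def binTree {I : Type*} (s : I → ℕ) :
    SimpleGraph (Option (Σ i : I, Option (Fin (s i - 1)))) :=
  SimpleGraph.fromRel fun x y =>
    (∃ i : I, x = none ∧ y = some ⟨i, none⟩) ∨
    (∃ (i : I) (t : Fin (s i - 1)), x = some ⟨i, none⟩ ∧ y = some ⟨i, some t⟩)

/-- The parent of a non-root vertex. -/
def btPar {I : Type*} {s : I → ℕ} :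
    (Σ i : I, Option (Fin (s i - 1))) → Option (Σ i : I, Option (Fin (s i - 1)))
  | ⟨_, none⟩ => none
  | ⟨i, some _⟩ => some ⟨i, none⟩

theorem btPar_ne {I : Type*} {s : I → ℕ} (v : Σ i : I, Option (Fin (s i - 1))) :
    btPar v ≠ some v := by
  rcases v with ⟨i, _ | t⟩ <;> simp [btPar]

theorem btPar_asymm {I : Type*} {s : I → ℕ} (u v : Σ i : I, Option (Fin (s i - 1)))
    (h1 : btPar v = some u) (h2 : btPar u = some v) : False := by
  rcases v with ⟨i, _ | t⟩ <;> rcases u with ⟨j, _ | t'⟩ <;> simp [btPar] at h1 h2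
  obtain ⟨rfl, h⟩ := h1
  simp at h

theorem bt_adj_par {I : Type*} {s : I → ℕ} (v : Σ i : I, Option (Fin (s i - 1))) :
    (binTree s).Adj (btPar v) (some v) := by
  rw [binTree, SimpleGraph.fromRel_adj]
  refine ⟨btPar_ne v, Or.inl ?_⟩
  rcases v with ⟨i, _ | t⟩
  · exact Or.inl ⟨i, rfl, rfl⟩
  · exact Or.inr ⟨i, t, rfl, rfl⟩

theorem bt_adj {I : Type*} {s : I → ℕ} {x y : Option (Σ i : I, Option (Fin (s i - 1)))}
    (h : (binTree s).Adj x y) :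
    (∃ v, x = btPar v ∧ y = some v) ∨ (∃ v, x = some v ∧ y = btPar v) := by
  rw [binTree, SimpleGraph.fromRel_adj] at h
  rcases h with ⟨_, (⟨i, rfl, rfl⟩ | ⟨i, t, rfl, rfl⟩) | (⟨i, rfl, rfl⟩ | ⟨i, t, rfl, rfl⟩)⟩
  · exact Or.inl ⟨⟨i, none⟩, rfl, rfl⟩
  · exact Or.inl ⟨⟨i, some t⟩, rfl, rfl⟩
  · exact Or.inr ⟨⟨i, none⟩, rfl, rfl⟩
  · exact Or.inr ⟨⟨i, some t⟩, rfl, rfl⟩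

theorem bt_up {I : Type*} {s : I → ℕ} {x y : Option (Σ i : I, Option (Fin (s i - 1)))}
    (w : (binTree s).Walk x y) (hy : y = none) (v : Σ i : I, Option (Fin (s i - 1)))
    (hv : some v ∈ w.support) :
    ∃ d ∈ w.darts, d.toProd = (some v, btPar v) := by
  induction w generalizing v with
  | nil => subst hy; simp at hv
  | @cons a b c h p ih =>
    by_cases hp : some v ∈ p.support
    · obtain ⟨d, hd, e⟩ := ih hy v hp
      exact ⟨d, by simp [hd], e⟩
    · have hva : some v = a := by simpa [hp] using hv
      rcases bt_adj h with ⟨u, h1, h2⟩ | ⟨u, h1, h2⟩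
      · exfalso
        obtain ⟨d, hd, e⟩ := ih hy u (by rw [← h2]; exact p.start_mem_support)
        have := p.dart_snd_mem_support_of_mem_darts hd
        rw [e] at this
        simp only at this
        rw [← h1, ← hva] at this
        exact hp this
      · have : u = v := by rw [← hva] at h1; exact (Option.some.inj h1).symm
        subst this
        exact ⟨⟨(a, b), h⟩, by simp, by simp [h1, h2]⟩

theorem bt_down {I : Type*} {s : I → ℕ}
    (w : (binTree s).Walk none none) (v : Σ i : I, Option (Fin (s i - 1)))
    (hv : some v ∈ w.support) :
    ∃ d ∈ w.darts, d.toProd = (btPar v, some v) := by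
  obtain ⟨d, hd, e⟩ := bt_up w.reverse rfl v (by simpa using hv)
  rw [SimpleGraph.Walk.darts_reverse] at hd
  simp only [List.mem_reverse, List.mem_map] at hd
  obtain ⟨d', hd', rfl⟩ := hd
  refine ⟨d', hd', ?_⟩
  have := congrArg Prod.swap e
  simpa using this

theorem bt_count {I : Type*} [DecidableEq I] {s : I → ℕ}
    (w : (binTree s).Walk none none) (V : Finset (Σ i : I, Option (Fin (s i - 1))))
    (hV : ∀ v ∈ V, some v ∈ w.support) : 2 * V.card ≤ w.length := by
  classical
  have h1 : (V.image fun v => (some v, btPar v)).card = V.card :=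
    Finset.card_image_of_injective _ fun a b h => by simpa using congrArg Prod.fst h
  have h2 : (V.image fun v => (btPar v, some v)).card = V.card :=
    Finset.card_image_of_injective _ fun a b h => by simpa using congrArg Prod.snd h
  have hd : Disjoint (V.image fun v => (some v, btPar v))
      (V.image fun v => (btPar v, some v)) := by
    rw [Finset.disjoint_left]
    intro x hx hy
    obtain ⟨a, _, rfl⟩ := Finset.mem_image.1 hx
    obtain ⟨b, _, hb⟩ := Finset.mem_image.1 hy
    exact btPar_asymm a b (congrArg Prod.fst hb) (congrArg Prod.snd hb).symm
  have hsub : (V.image fun v => (some v, btPar v)) ∪ (V.image fun v => (btPar v, some v)) ⊆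
      (w.darts.map fun d => d.toProd).toFinset := by
    intro x hx
    rw [List.mem_toFinset, List.mem_map]
    rcases Finset.mem_union.1 hx with hx | hx
    · obtain ⟨a, ha, rfl⟩ := Finset.mem_image.1 hx
      exact bt_up w rfl a (hV a ha)
    · obtain ⟨a, ha, rfl⟩ := Finset.mem_image.1 hx
      exact bt_down w a (hV a ha)
  have h3 := (Finset.card_le_card hsub).trans (List.toFinset_card_le _)
  rw [Finset.card_union_of_disjoint hd, h1, h2, List.length_map,
    SimpleGraph.Walk.length_darts] at h3
  omega

theorem bt_star {I : Type*} {s : I → ℕ} (i : I) (F : Finset (Fin (s i - 1))) :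
    ∃ w : (binTree s).Walk (some ⟨i, none⟩) (some ⟨i, none⟩), w.length = 2 * F.card ∧
      ∀ t ∈ F, s(btPar ⟨i, some t⟩, some ⟨i, some t⟩) ∈ w.edges := by
  classical
  induction F using Finset.induction_on with
  | empty => exact ⟨.nil, by simp, by simp⟩
  | insert t F ht ih =>
    obtain ⟨w, hl, he⟩ := ih
    have h : (binTree s).Adj (some ⟨i, none⟩) (some ⟨i, some t⟩) := bt_adj_par ⟨i, some t⟩
    refine ⟨.cons h (.cons h.symm w), ?_, ?_⟩
    · simp [hl, Finset.card_insert_of_notMem ht]; ring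
    · intro t' ht'
      rcases Finset.mem_insert.1 ht' with rfl | h'
      · simp [btPar]
      · have := he t' h'
        rw [SimpleGraph.Walk.edges_cons, SimpleGraph.Walk.edges_cons]
        exact List.mem_cons_of_mem _ (List.mem_cons_of_mem _ this)

theorem bt_tour {I : Type*} [DecidableEq I] {s : I → ℕ} (hs : ∀ i, 1 ≤ s i) (S : Finset I) :
    ∃ w : (binTree s).Walk none none, w.length = 2 * ∑ i ∈ S, s i ∧
      ∀ v : (Σ i : I, Option (Fin (s i - 1))), v.1 ∈ S → s(btPar v, some v) ∈ w.edges := by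
  induction S using Finset.induction_on with
  | empty => exact ⟨.nil, by simp, by simp⟩
  | insert i S hi ih =>
    obtain ⟨w, hl, he⟩ := ih
    obtain ⟨p, pl, pe⟩ := bt_star (s := s) i Finset.univ
    have h : (binTree s).Adj none (some ⟨i, none⟩) := bt_adj_par ⟨i, none⟩
    refine ⟨.cons h (p.append (.cons h.symm w)), ?_, ?_⟩
    · have := hs i
      simp [hl, pl, Finset.sum_insert hi]
      omega
    · rintro ⟨j, o⟩ hv
      simp only [SimpleGraph.Walk.edges_cons, SimpleGraph.Walk.edges_append, List.mem_cons,
        List.mem_append]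
      rcases Finset.mem_insert.1 hv with h' | h'
      · simp only at h'
        subst h'
        rcases o with _ | t
        · exact Or.inl rfl
        · exact Or.inr (Or.inl (pe t (Finset.mem_univ _)))
      · exact Or.inr (Or.inr (Or.inr (he _ h')))

/-- Reduction from Exact Bin Packing to Collective Graph Exploration: the items
can be partitioned into `k` bins each of total size exactly `B` iff the tree
`binTree s` can be explored by `k` closed walks from the root, each of length
at most `2·B`. -/
theorem stmt_12 {I : Type*} [Fintype I] [DecidableEq I]
    (s : I → ℕ) (hs : ∀ i, 1 ≤ s i) (B k : ℕ) (hB : 1 ≤ B) (hk : 1 ≤ k)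
    (hsum : ∑ i, s i = B * k) :
    (∃ f : I → Fin k,
        ∀ j : Fin k, ∑ i ∈ Finset.univ.filter (fun i => f i = j), s i = B) ↔
    (∃ ws : Fin k → (binTree s).Walk none none,
        (∀ j, (ws j).length ≤ 2 * B) ∧
        ∀ e ∈ (binTree s).edgeSet, ∃ j, e ∈ (ws j).edges) := by
  classical
  constructor
  · rintro ⟨f, hf⟩
    choose ws hl he using fun j : Fin k =>
      bt_tour (s := s) hs (Finset.univ.filter (fun i => f i = j))
    refine ⟨ws, fun j => by rw [hl, hf], ?_⟩
    have key : ∀ v : (Σ i : I, Option (Fin (s i - 1))),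
        s(btPar v, some v) ∈ (ws (f v.1)).edges := fun v => he _ v (by simp)
    intro e
    induction e using Sym2.ind with
    | _ x y =>
      intro hxy
      rw [SimpleGraph.mem_edgeSet] at hxy
      rcases bt_adj hxy with ⟨v, rfl, rfl⟩ | ⟨v, rfl, rfl⟩
      · exact ⟨_, key v⟩
      · exact ⟨_, by rw [Sym2.eq_swap]; exact key v⟩
  · rintro ⟨ws, hl, he⟩
    let V : Fin k → Finset (Σ i : I, Option (Fin (s i - 1))) := fun j =>
      Finset.univ.filter fun v => some v ∈ (ws j).support
    have hV : ∀ j v, v ∈ V j ↔ some v ∈ (ws j).support := fun j v => by simp [V]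
    have hcard : ∀ j, (V j).card ≤ B := fun j => by
      have := bt_count (ws j) (V j) (fun v hv => (hV j v).1 hv)
      have := hl j
      omega
    have hcov : ∀ v, ∃ j, v ∈ V j := fun v => by
      obtain ⟨j, hj⟩ := he s(btPar v, some v) (bt_adj_par v)
      exact ⟨j, (hV j v).2 ((ws j).snd_mem_support_of_mem_edges hj)⟩
    have hpar : ∀ j i o, (⟨i, o⟩ : Σ i : I, Option (Fin (s i - 1))) ∈ V j →
        (⟨i, none⟩ : Σ i : I, Option (Fin (s i - 1))) ∈ V j := by
      rintro j i (_ | t) h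
      · exact h
      · obtain ⟨d, hd, e⟩ := bt_up (ws j) rfl _ ((hV _ _).1 h)
        have := (ws j).dart_snd_mem_support_of_mem_darts hd
        rw [e] at this
        exact (hV _ _).2 this
    have hN : Fintype.card (Σ i : I, Option (Fin (s i - 1))) = B * k := by
      rw [Fintype.card_sigma, ← hsum]
      refine Finset.sum_congr rfl fun i _ => ?_
      have := hs i
      simp; omega
    have hdc : ∑ v : (Σ i : I, Option (Fin (s i - 1))),
        (Finset.univ.filter fun j => v ∈ V j).card = ∑ j, (V j).card := by
      simp only [Finset.card_filter]
      rw [Finset.sum_comm]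
      simp
    have hge : ∀ v ∈ (Finset.univ : Finset (Σ i : I, Option (Fin (s i - 1)))),
        1 ≤ (Finset.univ.filter fun j => v ∈ V j).card := fun v _ => by
      obtain ⟨j, hj⟩ := hcov v
      exact Finset.card_pos.2 ⟨j, by simpa using hj⟩
    have hle : ∑ j, (V j).card ≤ B * k := by
      calc ∑ j, (V j).card ≤ ∑ _j : Fin k, B := Finset.sum_le_sum fun j _ => hcard j
        _ = B * k := by simp [mul_comm]
    have hone : ∀ v, 1 = (Finset.univ.filter fun j => v ∈ V j).card := by
      have h1 := (Finset.sum_eq_sum_iff_of_le hge).1 (le_antisymm (Finset.sum_le_sum hge) (by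
        rw [hdc]; simpa [-Fintype.card_sigma, hN] using hle))
      exact fun v => h1 v (Finset.mem_univ v)
    have huniq : ∀ v j j', v ∈ V j → v ∈ V j' → j = j' := fun v j j' h h' =>
      Finset.card_le_one.1 (hone v).ge j (by simpa using h) j' (by simpa using h')
    choose f hf using fun i : I => hcov ⟨i, none⟩
    have hall : ∀ v, v ∈ V (f v.1) := by
      rintro ⟨i, o⟩
      obtain ⟨j, hj⟩ := hcov ⟨i, o⟩
      have := huniq _ _ _ (hpar j i o hj) (hf i)
      simpa [← this] using hj
    refine ⟨f, ?_⟩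
    have hb : ∀ j ∈ (Finset.univ : Finset (Fin k)),
        ∑ i ∈ Finset.univ.filter (fun i => f i = j), s i ≤ B := fun j _ => by
      refine le_trans ?_ (hcard j)
      have hsub : (Finset.univ.filter (fun i => f i = j)).sigma
          (fun i => (Finset.univ : Finset (Option (Fin (s i - 1))))) ⊆ V j := by
        rintro ⟨i, o⟩ h
        have : f i = j := by simpa using h
        have h2 := hall ⟨i, o⟩
        simpa [this] using h2
      refine le_trans (le_of_eq ?_) (Finset.card_le_card hsub)
      rw [Finset.card_sigma]
      refine Finset.sum_congr rfl fun i _ => ?_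
      have := hs i
      simp; omega
    have htot : ∑ j, ∑ i ∈ Finset.univ.filter (fun i => f i = j), s i = ∑ _j : Fin k, B := by
      rw [Finset.sum_fiberwise, hsum]; simp [mul_comm]
    exact fun j => (Finset.sum_eq_sum_iff_of_le hb).1 htot j (Finset.mem_univ j)
end
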